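/- Let I = (0,a), 0 < a ≤ ∞, φ an Orlicz function and w a positive decreasing weight function on I which is regular, i.e. W(t) ≤ C t w(t) for some C > 0 and all t ∈ I, where W(t) = ∫₀ᵗ w. Then the class 𝓜_{φ,w} = { f : P(λf) < ∞ for some λ > 0 }, where P(f) = inf { ∫_I φ(|f|/v) v : v ≥ 0 measurable, v ≺ w }, coincides with the class M_{φ,w} = { f : ∫_I φ(λ f*/w) w < ∞ for some λ > 0 }, and the associated functionals ‖f‖_𝓜 = inf{ ε : P(f/ε) ≤ 1 } and ‖f‖_M = inf{ ε : ∫_I φ(f*/(ε w)) w ≤ 1 } are equivalent. -/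

import Mathlib

open MeasureTheory Set Filter Topology ENNReal

noncomputable section

namespace OrliczRearrangement

/-- An Orlicz function: convex on `[0,∞)`, strictly increasing on `[0,∞)` and vanishing at `0`. -/
def IsOrliczFn (φ : ℝ → ℝ) : Prop :=
  ConvexOn ℝ (Set.Ici 0) φ ∧ StrictMonoOn φ (Set.Ici 0) ∧ φ 0 = 0

/-- An `N`-function: an Orlicz function with `φ(t)/t → 0` as `t → 0⁺` and `φ(t)/t → ∞`
as `t → ∞`. -/
def IsNFn (φ : ℝ → ℝ) : Prop :=
  IsOrliczFn φ ∧ Filter.Tendsto (fun t => φ t / t) (nhdsWithin 0 (Set.Ioi 0)) (nhds 0) ∧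
    Filter.Tendsto (fun t => φ t / t) Filter.atTop Filter.atTop

/-- The complementary (conjugate) function `φ*(t) = sup_{s>0} (st - φ(s))`. -/
def conjFn (φ : ℝ → ℝ) (t : ℝ) : ℝ := sSup ((fun s => s * t - φ s) '' Set.Ioi 0)

/-- The interval `I = (0,a)`, `0 < a ≤ ∞`, as a subset of `ℝ`. -/
def Ioa' (a : ℝ≥0∞) : Set ℝ := {t : ℝ | 0 < t ∧ ENNReal.ofReal t < a}

/-- Distribution function `d_f(s) = |{t ∈ (0,a) : |f(t)| > s}|`. -/
def distr (a : ℝ≥0∞) (f : ℝ → ℝ) (s : ℝ) : ℝ≥0∞ := volume {t ∈ Ioa' a | s < |f t|}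

/-- Decreasing rearrangement `f*(t) = inf{s ≥ 0 : d_f(s) ≤ t}` of `f` on `(0,a)`,
with value `∞` when no such `s` exists. -/
def decRe (a : ℝ≥0∞) (f : ℝ → ℝ) (t : ℝ) : ℝ≥0∞ :=
  sInf (ENNReal.ofReal '' {s : ℝ | 0 ≤ s ∧ distr a f s ≤ ENNReal.ofReal t})

/-- Distribution of a sequence: `d_x(s) = |{k : |x(k)| > s}|`. -/
def sdistr (x : ℕ → ℝ) (s : ℝ) : ℕ∞ := {k : ℕ | s < |x k|}.encard

/-- Decreasing rearrangement of a sequence (`0`-indexed):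
`x*(n) = inf{s > 0 : d_x(s) ≤ n}`, with value `∞` when no such `s` exists. -/
def sdecRe (x : ℕ → ℝ) (n : ℕ) : ℝ≥0∞ :=
  sInf (ENNReal.ofReal '' {s : ℝ | 0 < s ∧ sdistr x s ≤ (n : ℕ∞)})

/-- The extended-real quantity `φ(c/v)·v`, with the convention that for `v = 0` it equals
`0` if `c = 0` and `∞` if `c ≠ 0`. -/
def oterm (φ : ℝ → ℝ) (c v : ℝ) : ℝ≥0∞ :=
  if v = 0 then (if c = 0 then 0 else ∞) else ENNReal.ofReal (φ (c / v) * v)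

/-- The quantity `φ(c/v)·v` for an extended-real numerator `c`; it equals `∞` when
`c = ∞`. -/
def otermE (φ : ℝ → ℝ) (c : ℝ≥0∞) (v : ℝ) : ℝ≥0∞ :=
  if c = ∞ then ∞ else oterm φ c.toReal v

/-- The modular `M(f) = ∫_I φ(f*/w)·w`. -/
def Mmod (a : ℝ≥0∞) (φ w f : ℝ → ℝ) : ℝ≥0∞ :=
  ∫⁻ t in Ioa' a, otermE φ (decRe a f t) (w t)

/-- The functional `‖f‖_M = inf{ε > 0 : M(f/ε) ≤ 1}` (equal to `∞` if no such `ε`). -/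
def Mnorm (a : ℝ≥0∞) (φ w f : ℝ → ℝ) : ℝ≥0∞ :=
  ⨅ ε ∈ {ε : ℝ | 0 < ε ∧ Mmod a φ w (fun t => f t / ε) ≤ 1}, ENNReal.ofReal ε

/-- The class `M_{φ,w}` of measurable `f` with `M(λf) < ∞` for some `λ > 0`. -/
def Mclass (a : ℝ≥0∞) (φ w : ℝ → ℝ) : Set (ℝ → ℝ) :=
  {f | Measurable f ∧ ∃ c > 0, Mmod a φ w (fun t => c * f t) < ∞}

/-- Submajorization `v ≺ w` on `(0,a)`: `∫₀ᵗ v* ≤ ∫₀ᵗ w*` for all `t ∈ (0,a)`. -/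
def Submaj (a : ℝ≥0∞) (v w : ℝ → ℝ) : Prop :=
  ∀ t ∈ Ioa' a, ∫⁻ s in Set.Ioo 0 t, decRe a v s ≤ ∫⁻ s in Set.Ioo 0 t, decRe a w s

/-- The modular `P`, for (decreasing-rearrangement-like) `[0,∞]`-valued data `F`:
`P(F) = inf{∫_I φ(F/v)·v : v ≥ 0, v ≺ w}`. -/
def PmodE (a : ℝ≥0∞) (φ w : ℝ → ℝ) (F : ℝ → ℝ≥0∞) : ℝ≥0∞ :=
  ⨅ v ∈ {v : ℝ → ℝ | Measurable v ∧ (∀ t, 0 ≤ v t) ∧ Submaj a v w},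
    ∫⁻ t in Ioa' a, otermE φ (F t) (v t)

/-- The modular `P(f) = inf{∫_I φ(|f|/v)·v : v ≥ 0, v ≺ w}`. -/
def Pmod (a : ℝ≥0∞) (φ w f : ℝ → ℝ) : ℝ≥0∞ :=
  PmodE a φ w fun t => ENNReal.ofReal |f t|

/-- The norm of `𝓜_{φ,w}` for `[0,∞]`-valued data. -/
def PnormE (a : ℝ≥0∞) (φ w : ℝ → ℝ) (F : ℝ → ℝ≥0∞) : ℝ≥0∞ :=
  ⨅ ε ∈ {ε : ℝ | 0 < ε ∧ PmodE a φ w (fun t => F t / ENNReal.ofReal ε) ≤ 1},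
    ENNReal.ofReal ε

/-- The norm `‖f‖_𝓜 = inf{ε > 0 : P(f/ε) ≤ 1}`. -/
def Pnorm (a : ℝ≥0∞) (φ w f : ℝ → ℝ) : ℝ≥0∞ :=
  PnormE a φ w fun t => ENNReal.ofReal |f t|

/-- The space `𝓜_{φ,w}` of measurable `f` with `P(λf) < ∞` for some `λ > 0`. -/
def Pclass (a : ℝ≥0∞) (φ w : ℝ → ℝ) : Set (ℝ → ℝ) :=
  {f | Measurable f ∧ ∃ c > 0, Pmod a φ w (fun t => c * f t) < ∞}

/-- Sequence submajorization `v ≺ w`. -/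
def sSubmaj (v w : ℕ → ℝ) : Prop :=
  ∀ m : ℕ, ∑ n ∈ Finset.range m, sdecRe v n ≤ ∑ n ∈ Finset.range m, sdecRe w n

/-- Sequence modular `p` for `[0,∞]`-valued data. -/
def spmodE (φ : ℝ → ℝ) (w : ℕ → ℝ) (X : ℕ → ℝ≥0∞) : ℝ≥0∞ :=
  ⨅ v ∈ {v : ℕ → ℝ | (∀ n, 0 ≤ v n) ∧ sSubmaj v w}, ∑' n, otermE φ (X n) (v n)

/-- Sequence modular `p(x) = inf{∑ φ(|x(n)|/v(n))·v(n) : v ≥ 0, v ≺ w}`. -/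
def spmod (φ : ℝ → ℝ) (w x : ℕ → ℝ) : ℝ≥0∞ :=
  spmodE φ w fun n => ENNReal.ofReal |x n|

/-- Sequence norm for `[0,∞]`-valued data. -/
def spnormE (φ : ℝ → ℝ) (w : ℕ → ℝ) (X : ℕ → ℝ≥0∞) : ℝ≥0∞ :=
  ⨅ ε ∈ {ε : ℝ | 0 < ε ∧ spmodE φ w (fun n => X n / ENNReal.ofReal ε) ≤ 1},
    ENNReal.ofReal ε

/-- Sequence norm `‖x‖_𝔪 = inf{ε > 0 : p(x/ε) ≤ 1}`. -/
def spnorm (φ : ℝ → ℝ) (w x : ℕ → ℝ) : ℝ≥0∞ :=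
  spnormE φ w fun n => ENNReal.ofReal |x n|

/-- Dilation operator `D₂f(t) = f(t/2)`, where `f` is extended by `0` outside `(0,a)`. -/
def D2 (a : ℝ≥0∞) (f : ℝ → ℝ) : ℝ → ℝ := fun t => (Ioa' a).indicator f (t / 2)

/-- A measure preserving transformation from `S` onto `S`. -/
def MeasPresOn (σ : ℝ → ℝ) (S : Set ℝ) : Prop :=
  Set.MapsTo σ S S ∧ Set.SurjOn σ S S ∧ Measurable σ ∧
    ∀ A : Set ℝ, A ⊆ S → MeasurableSet A → volume (S ∩ σ ⁻¹' A) = volume A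

/-- Luxemburg norm of the weighted Orlicz space `L_φ(w)` on `(0,a)`. -/
def luxNorm (a : ℝ≥0∞) (φ w g : ℝ → ℝ) : ℝ≥0∞ :=
  ⨅ ε ∈ {ε : ℝ | 0 < ε ∧
      ∫⁻ t in Ioa' a, ENNReal.ofReal (φ (|g t| / ε) * w t) ≤ 1}, ENNReal.ofReal ε

/-- The Orlicz norm of `f` in `Λ_{φ*,w}`, defined by duality with the unit ball of
`L_φ(w)`: `‖f‖⁰ = sup{∫_I f° g w : g ≥ 0, ‖g‖_{L_φ(w)} ≤ 1}`. -/
def lamOnorm (a : ℝ≥0∞) (φ w f : ℝ → ℝ) : ℝ≥0∞ :=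
  ⨆ g ∈ {g : ℝ → ℝ | Measurable g ∧ (∀ t, 0 ≤ g t) ∧ luxNorm a φ w g ≤ 1},
    ∫⁻ t in Ioa' a, decRe a f t * ENNReal.ofReal (g t * w t)

/-- The Orlicz–Lorentz class `Λ_{φs,w}`: measurable `g` whose (finite) decreasing
rearrangement satisfies `∫_I φs(c·g°)·w < ∞` for some `c > 0`. -/
def LamClass (a : ℝ≥0∞) (φs w : ℝ → ℝ) : Set (ℝ → ℝ) :=
  {g | Measurable g ∧ (∀ t ∈ Ioa' a, decRe a g t < ∞) ∧
    ∃ c > 0, ∫⁻ t in Ioa' a, ENNReal.ofReal (φs (c * (decRe a g t).toReal) * w t) < ∞}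

/-- The (generalized right-continuous) inverse `φ⁻¹(y) = inf{s ≥ 0 : φ(s) ≥ y}`. -/
def phiInv (φ : ℝ → ℝ) (y : ℝ) : ℝ := sInf {s : ℝ | 0 ≤ s ∧ y ≤ φ s}

/-! ### The function `φ(c/v)·v` -/

lemma IsOrliczFn.nonneg {φ : ℝ → ℝ} (hφ : IsOrliczFn φ) {x : ℝ} (hx : 0 ≤ x) : 0 ≤ φ x := by
  have := hφ.2.1.monotoneOn (Set.mem_Ici.2 le_rfl) (Set.mem_Ici.2 hx) hx
  rwa [hφ.2.2] at this

lemma IsOrliczFn.pos {φ : ℝ → ℝ} (hφ : IsOrliczFn φ) {x : ℝ} (hx : 0 < x) : 0 < φ x := by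
  have := hφ.2.1 (Set.mem_Ici.2 le_rfl) (Set.mem_Ici.2 hx.le) hx
  rwa [hφ.2.2] at this

lemma IsOrliczFn.map_mul_le {φ : ℝ → ℝ} (hφ : IsOrliczFn φ) {θ x : ℝ} (hθ : 0 ≤ θ) (hθ1 : θ ≤ 1)
    (hx : 0 ≤ x) : φ (θ * x) ≤ θ * φ x := by
  have := hφ.1.2 (Set.mem_Ici.2 hx) (Set.mem_Ici.2 (le_refl (0 : ℝ))) hθ (sub_nonneg.2 hθ1)
    (by ring)
  simpa [hφ.2.2] using this

lemma otermE_mono_left {φ : ℝ → ℝ} (hφ : IsOrliczFn φ) {c d : ℝ≥0∞} (h : c ≤ d) {v : ℝ}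
    (hv : 0 ≤ v) : otermE φ c v ≤ otermE φ d v := by
  unfold otermE
  by_cases hd : d = ∞
  · simp [hd]
  have hc : c ≠ ∞ := ne_top_of_le_ne_top hd h
  have hcd : c.toReal ≤ d.toReal := ENNReal.toReal_mono hd h
  rw [if_neg hc, if_neg hd]
  unfold oterm
  by_cases hv0 : v = 0
  · rw [if_pos hv0, if_pos hv0]
    by_cases hc0 : c.toReal = 0
    · simp [hc0]
    · have : d.toReal ≠ 0 := by
        have := lt_of_le_of_ne (ENNReal.toReal_nonneg (a := c)) (Ne.symm hc0)
        exact (this.trans_le hcd).ne'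
      simp [this]
  · rw [if_neg hv0, if_neg hv0]
    refine ENNReal.ofReal_le_ofReal (mul_le_mul_of_nonneg_right ?_ hv)
    refine hφ.2.1.monotoneOn ?_ ?_ ?_
    · exact div_nonneg ENNReal.toReal_nonneg hv
    · exact div_nonneg ENNReal.toReal_nonneg hv
    · gcongr

lemma otermE_anti_right {φ : ℝ → ℝ} (hφ : IsOrliczFn φ) (c : ℝ≥0∞) {u v : ℝ} (hu : 0 ≤ u)
    (huv : u ≤ v) : otermE φ c v ≤ otermE φ c u := by
  unfold otermE
  by_cases hc : c = ∞
  · simp [hc]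
  rw [if_neg hc, if_neg hc]
  unfold oterm
  have hc0 : 0 ≤ c.toReal := ENNReal.toReal_nonneg
  by_cases hu0 : u = 0
  · rw [if_pos hu0]
    by_cases h0 : c.toReal = 0
    · simp [h0, hφ.2.2]
    · simp [h0]
  have hu' : 0 < u := lt_of_le_of_ne hu (Ne.symm hu0)
  have hv' : 0 < v := hu'.trans_le huv
  rw [if_neg hu0, if_neg hv'.ne']
  refine ENNReal.ofReal_le_ofReal ?_
  have h := hφ.map_mul_le (θ := u / v) (x := c.toReal / u) (by positivity)
    ((div_le_one hv').2 huv) (by positivity)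
  have e : u / v * (c.toReal / u) = c.toReal / v := by field_simp
  rw [e] at h
  calc φ (c.toReal / v) * v ≤ (u / v * φ (c.toReal / u)) * v := by gcongr
    _ = φ (c.toReal / u) * u := by field_simp

lemma otermE_mul_right (φ : ℝ → ℝ) (c : ℝ≥0∞) {k : ℝ} (hk : 0 < k) (v : ℝ) :
    otermE φ c (k * v) = ENNReal.ofReal k * otermE φ (c / ENNReal.ofReal k) v := by
  have hk' : ENNReal.ofReal k ≠ 0 := by simpa using hk
  unfold otermE
  by_cases hc : c = ∞
  · simp [hc, ENNReal.top_div, ENNReal.mul_top hk']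
  have hc' : c / ENNReal.ofReal k ≠ ∞ := ENNReal.div_ne_top hc hk'
  rw [if_neg hc, if_neg hc']
  unfold oterm
  have e : (c / ENNReal.ofReal k).toReal = c.toReal / k := by
    rw [ENNReal.toReal_div, ENNReal.toReal_ofReal hk.le]
  rw [e]
  by_cases hv : v = 0
  · by_cases h0 : c.toReal = 0
    · simp [hv, h0]
    · simp [hv, h0, hk.ne', ENNReal.mul_top hk']
  · rw [if_neg (mul_ne_zero hk.ne' hv), if_neg hv, ← ENNReal.ofReal_mul hk.le]
    congr 1
    rw [div_div]
    ring

lemma otermE_pos {φ : ℝ → ℝ} (hφ : IsOrliczFn φ) {c : ℝ≥0∞} (hc : 0 < c) {v : ℝ} (hv : 0 < v) :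
    0 < otermE φ c v := by
  unfold otermE
  by_cases hc' : c = ∞
  · simp [hc']
  have := ENNReal.toReal_pos hc.ne' hc'
  rw [if_neg hc', oterm, if_neg hv.ne', ENNReal.ofReal_pos]
  exact mul_pos (hφ.pos (by positivity)) hv

lemma natCast_mul_otermE_one_le {φ : ℝ → ℝ} (hφ : IsOrliczFn φ) {n : ℕ} (hn : 1 ≤ n) {v : ℝ}
    (hv : 0 < v) : (n : ℝ≥0∞) * otermE φ 1 v ≤ otermE φ n v := by
  have hn' : (1 : ℝ) ≤ n := by exact_mod_cast hn
  have hn0 : (0 : ℝ) < n := by linarith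
  unfold otermE
  rw [if_neg ENNReal.one_ne_top, if_neg (ENNReal.natCast_ne_top n)]
  unfold oterm
  rw [if_neg hv.ne', if_neg hv.ne', ← ENNReal.ofReal_natCast, ← ENNReal.ofReal_mul hn0.le]
  refine ENNReal.ofReal_le_ofReal ?_
  rw [ENNReal.toReal_ofReal hn0.le, ENNReal.toReal_one]
  have h := hφ.map_mul_le (θ := (n : ℝ)⁻¹) (x := n / v) (by positivity)
    (inv_le_one_of_one_le₀ hn') (by positivity)
  have e : (n : ℝ)⁻¹ * (n / v) = 1 / v := by field_simp
  rw [e] at h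
  calc (n : ℝ) * (φ (1 / v) * v) ≤ n * (((n : ℝ)⁻¹ * φ (n / v)) * v) := by gcongr
    _ = φ (n / v) * v := by field_simp

lemma aemeasurable_otermE {φ : ℝ → ℝ} (hφ : IsOrliczFn φ) {F : ℝ → ℝ≥0∞} (hF : Measurable F)
    {v : ℝ → ℝ} (hv : Measurable v) {S : Set ℝ} (hS : MeasurableSet S) (hv0 : ∀ t ∈ S, 0 ≤ v t) :
    AEMeasurable (fun t => otermE φ (F t) (v t)) (volume.restrict S) := by
  have hmono : Monotone fun x => φ (max x 0) := fun x y hxy =>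
    hφ.2.1.monotoneOn (Set.mem_Ici.2 (le_max_right _ _)) (Set.mem_Ici.2 (le_max_right _ _))
      (max_le_max_right 0 hxy)
  have hG : Measurable fun t => otermE (fun x => φ (max x 0)) (F t) (v t) := by
    unfold otermE oterm
    refine Measurable.ite (hF (measurableSet_singleton _)) measurable_const ?_
    refine Measurable.ite (hv (measurableSet_singleton _)) ?_ ?_
    · exact Measurable.ite (hF.ennreal_toReal (measurableSet_singleton _)) measurable_const
        measurable_const
    · exact ((hmono.measurable.comp (hF.ennreal_toReal.div hv)).mul hv).ennreal_ofReal
  refine ⟨_, hG, (ae_restrict_iff' hS).2 (ae_of_all _ fun t ht => ?_)⟩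
  have : max ((F t).toReal / v t) 0 = (F t).toReal / v t :=
    max_eq_left (div_nonneg ENNReal.toReal_nonneg (hv0 t ht))
  simp only [otermE, oterm, this]

/-! ### Distribution functions and rearrangements -/

lemma measurableSet_Ioa' (a : ℝ≥0∞) : MeasurableSet (Ioa' a) :=
  measurableSet_Ioi.inter (ENNReal.measurable_ofReal measurableSet_Iio)

lemma Ioo_subset_Ioa' {a : ℝ≥0∞} {t : ℝ} (ht : ENNReal.ofReal t ≤ a) : Set.Ioo 0 t ⊆ Ioa' a :=
  fun _ hs => ⟨hs.1, ((ENNReal.ofReal_lt_ofReal_iff (hs.1.trans hs.2)).2 hs.2).trans_le ht⟩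

lemma Ioa'_mem_of_le {a : ℝ≥0∞} {s t : ℝ} (ht : t ∈ Ioa' a) (hs : 0 < s) (hst : s ≤ t) :
    s ∈ Ioa' a :=
  ⟨hs, (ENNReal.ofReal_le_ofReal hst).trans_lt ht.2⟩

/-- The points whose upper level set has measure at most `c` form a set of measure at most `c`. -/
lemma measure_setOf_measure_le_le {α : Type*} [MeasurableSpace α] (μ : Measure α) (u : α → ℝ)
    (c : ℝ≥0∞) : μ {x | μ {y | u x ≤ u y} ≤ c} ≤ c := by
  set L : Set ℝ := {l | μ {y | l ≤ u y} ≤ c} with hL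
  have hup : ∀ l ∈ L, ∀ m, l ≤ m → m ∈ L := fun l hl m hlm =>
    (measure_mono fun y (hy : m ≤ u y) => hlm.trans hy).trans hl
  by_cases hmin : ∃ l ∈ L, ∀ m ∈ L, l ≤ m
  · obtain ⟨l, hl, hlm⟩ := hmin
    exact (measure_mono fun x hx => hlm (u x) hx).trans hl
  · push Not at hmin
    obtain ⟨T, hTL, hTc, hT⟩ := TopologicalSpace.isOpen_biUnion_countable L (fun l => Set.Ioi l)
      fun l _ => isOpen_Ioi
    have hsub : {x | μ {y | u x ≤ u y} ≤ c} ⊆ ⋃ l ∈ T, u ⁻¹' Set.Ioi l := by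
      intro x hx
      obtain ⟨m, hm, hmx⟩ := hmin (u x) hx
      have : u x ∈ ⋃ l ∈ T, Set.Ioi l := by
        rw [hT]
        exact Set.mem_biUnion hm hmx
      simpa using this
    refine (measure_mono hsub).trans ?_
    rw [measure_biUnion_eq_iSup hTc]
    · exact iSup₂_le fun l hl =>
        (measure_mono fun y (hy : l < u y) => hy.le).trans (hTL hl)
    · intro l hl m hm
      refine ⟨min l m, ?_, ?_, ?_⟩
      · rcases min_choice l m with h | h <;> rwa [h]
      · exact fun y (hy : l < u y) => (min_le_left l m).trans_lt hy
      · exact fun y (hy : m < u y) => (min_le_right l m).trans_lt hy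

lemma distr_eq (a : ℝ≥0∞) (f : ℝ → ℝ) (s : ℝ) :
    distr a f s = volume.restrict (Ioa' a) {x | s < |f x|} := by
  rw [Measure.restrict_apply' (measurableSet_Ioa' a), Set.inter_comm]
  rfl

lemma volume_Ioa' (a : ℝ≥0∞) : volume (Ioa' a) = a := by
  by_cases ha : a = ∞
  · have : Ioa' a = Set.Ioi 0 := by
      ext t; simp [Ioa', ha]
    rw [this, ha, Real.volume_Ioi]
  · have : Ioa' a = Set.Ioo 0 a.toReal := by
      ext t
      simp only [Ioa', Set.mem_ofPred_eq, Set.mem_Ioo, and_congr_right_iff]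
      intro ht
      rw [ENNReal.ofReal_lt_iff_lt_toReal ht.le ha]
    rw [this, Real.volume_Ioo, sub_zero, ENNReal.ofReal_toReal ha]

/-- The measure of the closed upper level set `{t ∈ (0,a) : |f(t)| ≥ s}`. -/
def upDistr (a : ℝ≥0∞) (f : ℝ → ℝ) (s : ℝ) : ℝ≥0∞ :=
  volume.restrict (Ioa' a) {x | s ≤ |f x|}

lemma upDistr_anti (a : ℝ≥0∞) (f : ℝ → ℝ) : Antitone (upDistr a f) := fun _ _ h =>
  measure_mono fun _ hx => h.trans hx

lemma measurable_upDistr (a : ℝ≥0∞) {f : ℝ → ℝ} (hf : Measurable f) :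
    Measurable fun x => upDistr a f |f x| :=
  (upDistr_anti a f).measurable.comp hf.abs

lemma upDistr_le (a : ℝ≥0∞) (f : ℝ → ℝ) (s : ℝ) : upDistr a f s ≤ a :=
  (measure_mono (Set.subset_univ _)).trans (by rw [Measure.restrict_apply_univ, volume_Ioa'])

lemma upDistr_le_distr (a : ℝ≥0∞) (f : ℝ → ℝ) {r s : ℝ} (h : r < s) :
    upDistr a f s ≤ distr a f r := by
  rw [distr_eq]
  exact measure_mono fun _ hx => h.trans_le hx

lemma measure_upDistr_le_le (a : ℝ≥0∞) (f : ℝ → ℝ) (c : ℝ≥0∞) :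
    volume.restrict (Ioa' a) {x | upDistr a f |f x| ≤ c} ≤ c :=
  measure_setOf_measure_le_le _ (fun x => |f x|) c

lemma decRe_anti (a : ℝ≥0∞) (f : ℝ → ℝ) : Antitone (decRe a f) := fun _ _ h =>
  sInf_le_sInf (Set.image_mono fun _ hs => ⟨hs.1, hs.2.trans (ENNReal.ofReal_le_ofReal h)⟩)

lemma decRe_le (a : ℝ≥0∞) (f : ℝ → ℝ) {s t : ℝ} (hs : 0 ≤ s)
    (h : distr a f s ≤ ENNReal.ofReal t) : decRe a f t ≤ ENNReal.ofReal s :=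
  sInf_le ⟨s, ⟨hs, h⟩, rfl⟩

lemma decRe_le_decRe {a : ℝ≥0∞} {v w : ℝ → ℝ}
    (h : ∀ s, 0 ≤ s → distr a v s ≤ distr a w s) (t : ℝ) : decRe a v t ≤ decRe a w t :=
  sInf_le_sInf (Set.image_mono fun s hs => ⟨hs.1, (h s hs.1).trans hs.2⟩)

lemma le_decRe_of_lt_upDistr (a : ℝ≥0∞) (f : ℝ → ℝ) {s t : ℝ}
    (h : ENNReal.ofReal t < upDistr a f s) : ENNReal.ofReal s ≤ decRe a f t := by
  refine le_sInf ?_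
  rintro _ ⟨r, ⟨-, hr⟩, rfl⟩
  refine ENNReal.ofReal_le_ofReal (le_of_not_gt fun hrs => ?_)
  exact absurd (h.trans_le (upDistr_le_distr a f hrs)) (not_lt.2 hr)

lemma lt_distr_of_lt_decRe (a : ℝ≥0∞) (f : ℝ → ℝ) {s t : ℝ} (hs : 0 ≤ s)
    (h : ENNReal.ofReal s < decRe a f t) : ENNReal.ofReal t < distr a f s :=
  lt_of_not_ge fun h' => absurd h (not_lt.2 (decRe_le a f hs h'))

lemma measure_decRe_lt_le (a : ℝ≥0∞) (f : ℝ → ℝ) (t : ℝ) :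
    volume.restrict (Ioa' a) {x | decRe a f t < ENNReal.ofReal |f x|} ≤ ENNReal.ofReal t := by
  refine (measure_mono fun x (hx : decRe a f t < ENNReal.ofReal |f x|) => ?_).trans
    (measure_upDistr_le_le a f (ENNReal.ofReal t))
  obtain ⟨_, ⟨s, hs, rfl⟩, hsx⟩ := sInf_lt_iff.1 hx
  exact (upDistr_le_distr a f (ENNReal.ofReal_lt_ofReal_iff'.1 hsx).1).trans hs.2

lemma decRe_div_le (a : ℝ≥0∞) (f : ℝ → ℝ) {k : ℝ} (hk : 0 < k) (t : ℝ) :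
    decRe a (fun x => f x / k) t ≤ decRe a f t / ENNReal.ofReal k := by
  have hk' : ENNReal.ofReal k ≠ 0 := by simpa using hk
  rw [ENNReal.le_div_iff_mul_le (Or.inl hk') (Or.inl ENNReal.ofReal_ne_top)]
  refine le_sInf ?_
  rintro _ ⟨s, ⟨hs, hd⟩, rfl⟩
  have : decRe a (fun x => f x / k) t ≤ ENNReal.ofReal (s / k) := by
    refine decRe_le a _ (by positivity) (le_trans (le_of_eq ?_) hd)
    simp only [distr, abs_div, abs_of_pos hk, div_lt_div_iff_of_pos_right hk]
  calc _ ≤ ENNReal.ofReal (s / k) * ENNReal.ofReal k := by gcongr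
    _ = ENNReal.ofReal s := by
      rw [← ENNReal.ofReal_mul (by positivity), div_mul_cancel₀ _ hk.ne']

lemma otermE_zero_left {φ : ℝ → ℝ} (hφ : IsOrliczFn φ) (v : ℝ) : otermE φ 0 v = 0 := by
  simp [otermE, oterm, hφ.2.2]

/-! ### Regular weights -/

section Weight

variable {a : ℝ≥0∞} {w : ℝ → ℝ} {C : ℝ}

lemma regular_weight_le (hw_dec : ∀ s ∈ Ioa' a, ∀ t ∈ Ioa' a, s ≤ t → w t ≤ w s)
    (hw_pos : ∀ t ∈ Ioa' a, 0 < w t) (hC : 0 < C)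
    (hreg : ∀ t ∈ Ioa' a,
      ∫⁻ s in Set.Ioo 0 t, ENNReal.ofReal (w s) ≤ ENNReal.ofReal (C * t * w t))
    {s t : ℝ} (hs : s ∈ Ioa' a) (ht : t ∈ Ioa' a) (hst : s ≤ t) (hts : t ≤ 4 * s) :
    w s ≤ 4 * C * w t := by
  have hs0 : 0 < s := hs.1
  have h1 : ENNReal.ofReal (w s) * ENNReal.ofReal s
      ≤ ∫⁻ r in Set.Ioo 0 s, ENNReal.ofReal (w r) := by
    have : ∫⁻ r in Set.Ioo 0 s, ENNReal.ofReal (w s)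
        ≤ ∫⁻ r in Set.Ioo 0 s, ENNReal.ofReal (w r) :=
      setLIntegral_mono' measurableSet_Ioo fun r hr => ENNReal.ofReal_le_ofReal
        (hw_dec r (Ioa'_mem_of_le hs hr.1 hr.2.le) s hs hr.2.le)
    simpa [Real.volume_Ioo] using this
  have h2 : ∫⁻ r in Set.Ioo 0 s, ENNReal.ofReal (w r)
      ≤ ∫⁻ r in Set.Ioo 0 t, ENNReal.ofReal (w r) :=
    lintegral_mono_set (Set.Ioo_subset_Ioo_right hst)
  have h3 := (h1.trans h2).trans (hreg t ht)
  have hwt := hw_pos t ht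
  have ht0 : 0 < t := ht.1
  rw [← ENNReal.ofReal_mul (hw_pos s hs).le, ENNReal.ofReal_le_ofReal_iff (by positivity)] at h3
  have h4 : C * t * w t ≤ C * (4 * s) * w t := by gcongr
  exact le_of_mul_le_mul_right (by linarith) hs0

lemma decRe_weight_le (hw_dec : ∀ s ∈ Ioa' a, ∀ t ∈ Ioa' a, s ≤ t → w t ≤ w s)
    (hw_pos : ∀ t ∈ Ioa' a, 0 < w t) {t : ℝ} (ht : t ∈ Ioa' a) :
    decRe a w t ≤ ENNReal.ofReal (w t) := by
  refine decRe_le a w (hw_pos t ht).le ?_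
  have : {x ∈ Ioa' a | w t < |w x|} ⊆ Set.Ioo 0 t := by
    rintro x ⟨hx, hxt⟩
    refine ⟨hx.1, lt_of_not_ge fun h => ?_⟩
    rw [abs_of_pos (hw_pos x hx)] at hxt
    exact absurd (hw_dec t ht x hx h) (not_le.2 hxt)
  refine (measure_mono this).trans ?_
  simp [Real.volume_Ioo]

lemma decRe_le_of_submaj (hw_dec : ∀ s ∈ Ioa' a, ∀ t ∈ Ioa' a, s ≤ t → w t ≤ w s)
    (hw_pos : ∀ t ∈ Ioa' a, 0 < w t)
    (hreg : ∀ t ∈ Ioa' a,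
      ∫⁻ s in Set.Ioo 0 t, ENNReal.ofReal (w s) ≤ ENNReal.ofReal (C * t * w t))
    {v : ℝ → ℝ} (hv : Submaj a v w) {t : ℝ} (ht : t ∈ Ioa' a) :
    decRe a v t ≤ ENNReal.ofReal (C * w t) := by
  have ht0 : 0 < t := ht.1
  have h1 : decRe a v t * ENNReal.ofReal t ≤ ∫⁻ r in Set.Ioo 0 t, decRe a v r := by
    have : ∫⁻ r in Set.Ioo 0 t, decRe a v t ≤ ∫⁻ r in Set.Ioo 0 t, decRe a v r :=
      setLIntegral_mono' measurableSet_Ioo fun r hr => decRe_anti a v hr.2.le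
    simpa [Real.volume_Ioo] using this
  have h2 : ∫⁻ r in Set.Ioo 0 t, decRe a w r ≤ ∫⁻ r in Set.Ioo 0 t, ENNReal.ofReal (w r) :=
    setLIntegral_mono' measurableSet_Ioo fun r hr =>
      decRe_weight_le hw_dec hw_pos (Ioa'_mem_of_le ht hr.1 hr.2.le)
  have h3 := ((h1.trans (hv t ht)).trans h2).trans (hreg t ht)
  rw [← ENNReal.le_div_iff_mul_le (Or.inl (by simpa using ht0)) (Or.inl ENNReal.ofReal_ne_top),
    ← ENNReal.ofReal_div_of_pos ht0] at h3
  refine h3.trans_eq ?_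
  congr 1
  field_simp

/-! ### Comparison of the two modulars -/

lemma lintegral_ite_ofReal_lt_le (a c : ℝ≥0∞) :
    ∫⁻ t in Ioa' a, (if ENNReal.ofReal t < 2 * c then 4 / c else 0) ≤ 8 := by
  have hm : MeasurableSet {t : ℝ | ENNReal.ofReal t < 2 * c} :=
    ENNReal.measurable_ofReal measurableSet_Iio
  have e : (fun t : ℝ => if ENNReal.ofReal t < 2 * c then 4 / c else 0)
      = {t : ℝ | ENNReal.ofReal t < 2 * c}.indicator fun _ => 4 / c := by
    ext t; simp [Set.indicator]
  rw [e, lintegral_indicator_const hm, Measure.restrict_apply hm]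
  have : {t : ℝ | ENNReal.ofReal t < 2 * c} ∩ Ioa' a ⊆ Ioa' (2 * c) := fun t ht => ⟨ht.2.1, ht.1⟩
  calc 4 / c * volume ({t : ℝ | ENNReal.ofReal t < 2 * c} ∩ Ioa' a)
      ≤ 4 / c * (2 * c) := by
        gcongr
        exact (measure_mono this).trans_eq (volume_Ioa' _)
    _ = 8 * (c⁻¹ * c) := by rw [div_eq_mul_inv]; ring
    _ ≤ 8 * 1 := by gcongr; exact ENNReal.inv_mul_le_one c
    _ = 8 := mul_one _

lemma lintegral_ite_upDistr_lt_le (a : ℝ≥0∞) {f : ℝ → ℝ} (hf : Measurable f) (c : ℝ≥0∞) :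
    ∫⁻ x in Ioa' a, (if upDistr a f |f x| < 2 * c then 2 / c else 0) ≤ 4 := by
  have hm : MeasurableSet {x : ℝ | upDistr a f |f x| < 2 * c} :=
    measurable_upDistr a hf measurableSet_Iio
  have e : (fun x : ℝ => if upDistr a f |f x| < 2 * c then 2 / c else 0)
      = {x : ℝ | upDistr a f |f x| < 2 * c}.indicator fun _ => 2 / c := by
    ext t; simp [Set.indicator]
  rw [e, lintegral_indicator_const hm]
  calc 2 / c * volume.restrict (Ioa' a) {x : ℝ | upDistr a f |f x| < 2 * c}
      ≤ 2 / c * (2 * c) := by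
        gcongr
        exact (measure_mono fun x (hx : upDistr a f |f x| < 2 * c) => hx.le).trans
          (measure_upDistr_le_le a f (2 * c))
    _ = 4 * (c⁻¹ * c) := by rw [div_eq_mul_inv]; ring
    _ ≤ 4 * 1 := by gcongr; exact ENNReal.inv_mul_le_one c
    _ = 4 := mul_one _

/-- An integral operator whose kernel has bounded column integrals is bounded on `L¹`. -/
lemma lintegral_lintegral_mul_le {α β : Type*} [MeasurableSpace α] [MeasurableSpace β]
    {μ : Measure α} {ν : Measure β} [SFinite μ] [SFinite ν] {g : β → ℝ≥0∞}
    (hg : AEMeasurable g ν) {k : α → β → ℝ≥0∞} (hk : Measurable (Function.uncurry k))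
    {c : ℝ≥0∞} (h : ∀ y, ∫⁻ x, k x y ∂μ ≤ c) :
    ∫⁻ x, ∫⁻ y, g y * k x y ∂ν ∂μ ≤ c * ∫⁻ y, g y ∂ν := by
  rw [lintegral_lintegral_swap (f := fun x y => g y * k x y)
    (hg.comp_snd.mul hk.aemeasurable), ← lintegral_const_mul'' _ hg]
  refine lintegral_mono fun y => ?_
  rw [lintegral_const_mul _ hk.of_uncurry_right, mul_comm]
  gcongr
  exact h y

variable {φ : ℝ → ℝ}

lemma Pmod_le_lintegral (hφ : IsOrliczFn φ) (hw_meas : Measurable w)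
    (hw_dec : ∀ s ∈ Ioa' a, ∀ t ∈ Ioa' a, s ≤ t → w t ≤ w s)
    (hw_pos : ∀ t ∈ Ioa' a, 0 < w t) {κ : ℝ} (hκ : 0 < κ)
    (hκw : ∀ s ∈ Ioa' a, ∀ t ∈ Ioa' a, s ≤ t → t ≤ 4 * s → κ * w s ≤ w t)
    {f : ℝ → ℝ} (hf : Measurable f) :
    Pmod a φ w f ≤ 4 * ∫⁻ t in Ioa' a, otermE φ (decRe a f t) (κ * w t) := by
  have hI := measurableSet_Ioa' a
  set h : ℝ → ℝ≥0∞ := fun x => upDistr a f |f x| with hh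
  have hhm : Measurable h := measurable_upDistr a hf
  by_cases hN : ∫⁻ t in Ioa' a, otermE φ (decRe a f t) (κ * w t) = ∞
  · rw [hN, ENNReal.mul_top (by norm_num)]
    exact le_top
  have hfin : ∀ x, f x ≠ 0 → h x ≠ ∞ := by
    intro x hx htop
    apply hN
    have ha : a = ∞ := top_le_iff.1 (htop ▸ upDistr_le a f _)
    have h1 : (1 : ℝ) ∈ Ioa' a := by simp [Ioa', ha]
    have hsub : Set.Ioi 1 ⊆ Ioa' a := fun t (ht : 1 < t) => by
      simp [Ioa', ha, zero_lt_one.trans ht]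
    have hδ : 0 < otermE φ (ENNReal.ofReal |f x|) (κ * w 1) :=
      otermE_pos hφ (by simpa using hx) (mul_pos hκ (hw_pos 1 h1))
    rw [← top_le_iff]
    calc ∞ = ∫⁻ t in Set.Ioi (1 : ℝ), otermE φ (ENNReal.ofReal |f x|) (κ * w 1) := by
          simp [ENNReal.mul_top hδ.ne']
      _ ≤ ∫⁻ t in Set.Ioi (1 : ℝ), otermE φ (decRe a f t) (κ * w t) := by
          refine setLIntegral_mono' measurableSet_Ioi fun t ht => ?_
          have hwt := hw_pos t (hsub ht)
          refine (otermE_anti_right hφ _ (by positivity) (mul_le_mul_of_nonneg_left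
            (hw_dec 1 h1 t (hsub ht) (le_of_lt ht)) hκ.le)).trans ?_
          refine otermE_mono_left hφ (le_decRe_of_lt_upDistr a f ?_) (by positivity)
          exact ENNReal.ofReal_lt_top.trans_eq htop.symm
      _ ≤ _ := lintegral_mono_set hsub
  set v : ℝ → ℝ := fun x => if h x = ∞ then 0 else max 0 (κ * w ((h x).toReal / 2)) with hv
  have hv_meas : Measurable v := Measurable.ite (hhm (measurableSet_singleton _))
    measurable_const (measurable_const.max
      ((hw_meas.comp (hhm.ennreal_toReal.div_const 2)).const_mul κ))
  have hv0 : ∀ t, 0 ≤ v t := fun t => by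
    simp only [hv]
    split_ifs
    · exact le_rfl
    · exact le_max_left _ _
  have hmem : ∀ x, h x ≠ ∞ → h x ≠ 0 → ∀ t, 0 < t → t < (h x).toReal → t ∈ Ioa' a :=
    fun x hx _ t ht htx =>
      ⟨ht, (ENNReal.ofReal_lt_iff_lt_toReal ht.le hx).2 htx |>.trans_le (upDistr_le a f _)⟩
  have hsubmaj : Submaj a v w := by
    intro t _
    refine lintegral_mono fun s => decRe_le_decRe (fun r hr => ?_) s
    rw [distr_eq a v]
    refine (measure_mono fun x (hx : r < |v x|) => ?_).trans
      (measure_upDistr_le_le a f (distr a w r))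
    change h x ≤ distr a w r
    rw [abs_of_nonneg (hv0 x)] at hx
    by_cases hx0 : h x = 0
    · simp [hx0]
    have hxt : h x ≠ ∞ := fun H => by
      simp only [hv, H, if_true] at hx
      exact absurd hx (not_lt.2 hr)
    simp only [hv, hxt, if_false, lt_max_iff, not_lt.2 hr, false_or] at hx
    have hpos : 0 < (h x).toReal := ENNReal.toReal_pos hx0 hxt
    have hmid := hmem x hxt hx0 ((h x).toReal / 2) (by linarith) (by linarith)
    have hsub : Set.Ioo 0 (h x).toReal ⊆ {y ∈ Ioa' a | r < |w y|} := by
      intro y hy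
      have hyI := hmem x hxt hx0 y hy.1 hy.2
      refine ⟨hyI, ?_⟩
      rw [abs_of_pos (hw_pos y hyI)]
      rcases le_total ((h x).toReal / 2) y with hle | hle
      · exact hx.trans_le (hκw _ hmid y hyI hle (by linarith [hy.2]))
      · exact hx.trans_le ((hκw _ hmid _ hmid le_rfl (by linarith)).trans
          (hw_dec y hyI _ hmid hle))
    calc h x = volume (Set.Ioo 0 (h x).toReal) := by
          rw [Real.volume_Ioo, sub_zero, ENNReal.ofReal_toReal hxt]
      _ ≤ _ := measure_mono hsub
  have hP : Pmod a φ w f ≤ ∫⁻ x in Ioa' a, otermE φ (ENNReal.ofReal |f x|) (v x) :=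
    iInf₂_le v ⟨hv_meas, hv0, hsubmaj⟩
  have hzero : ∀ᵐ x ∂volume.restrict (Ioa' a), h x ≠ 0 := by
    rw [ae_iff]
    have := measure_upDistr_le_le a f 0
    simpa [hh] using this
  refine hP.trans ?_
  set k : ℝ → ℝ → ℝ≥0∞ := fun x t =>
    if h x < 2 * ENNReal.ofReal t then 2 / ENNReal.ofReal t else 0 with hk
  have hkm : Measurable (Function.uncurry k) := by
    refine Measurable.ite (measurableSet_lt (hhm.comp measurable_fst)
      ((ENNReal.measurable_ofReal.comp measurable_snd).const_mul 2)) ?_ measurable_const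
    exact measurable_const.div (ENNReal.measurable_ofReal.comp measurable_snd)
  have hGm : AEMeasurable (fun t => otermE φ (decRe a f t) (κ * w t)) (volume.restrict (Ioa' a)) :=
    aemeasurable_otermE hφ (decRe_anti a f).measurable (hw_meas.const_mul κ) hI
      fun t ht => (mul_pos hκ (hw_pos t ht)).le
  refine le_trans (lintegral_mono_ae ?_) (lintegral_lintegral_mul_le hGm hkm
    fun t => lintegral_ite_upDistr_lt_le a hf (ENNReal.ofReal t))
  filter_upwards [hzero] with x hx0
  by_cases hfx : f x = 0
  · simp [hfx, otermE_zero_left hφ]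
  have hxt := hfin x hfx
  have hpos : 0 < (h x).toReal := ENNReal.toReal_pos hx0 hxt
  have hmid := hmem x hxt hx0 ((h x).toReal / 2) (by linarith) (by linarith)
  have hvx : v x = κ * w ((h x).toReal / 2) := by
    simp only [hv, hxt, if_false]
    exact max_eq_right (mul_pos hκ (hw_pos _ hmid)).le
  set Ψ := otermE φ (ENNReal.ofReal |f x|) (v x) with hΨ
  have hsub : Set.Ioo ((h x).toReal / 2) (h x).toReal ⊆ Ioa' a := fun t ht =>
    hmem x hxt hx0 t (by linarith [ht.1]) ht.2
  calc Ψ = Ψ * (2 / h x) * volume (Set.Ioo ((h x).toReal / 2) (h x).toReal) := by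
        have e : volume (Set.Ioo ((h x).toReal / 2) (h x).toReal) = h x / 2 := by
          rw [Real.volume_Ioo, _root_.sub_half, ENNReal.ofReal_div_of_pos two_pos,
            ENNReal.ofReal_toReal hxt]
          simp
        rw [e, mul_assoc, div_eq_mul_inv, div_eq_mul_inv]
        have e2 : 2 * (h x)⁻¹ * (h x * 2⁻¹) = (2 * 2⁻¹) * (h x * (h x)⁻¹) := by ring
        rw [e2, ENNReal.mul_inv_cancel hx0 hxt,
          ENNReal.mul_inv_cancel two_ne_zero ENNReal.ofNat_ne_top, one_mul, mul_one]
    _ = ∫⁻ t in Set.Ioo ((h x).toReal / 2) (h x).toReal, Ψ * (2 / h x) := by simp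
    _ ≤ ∫⁻ t in Set.Ioo ((h x).toReal / 2) (h x).toReal,
          otermE φ (decRe a f t) (κ * w t) * k x t := by
        refine setLIntegral_mono' measurableSet_Ioo fun t ht => ?_
        have ht0 : 0 < t := by linarith [ht.1]
        have htI := hsub ht
        have hth : ENNReal.ofReal t < h x := (ENNReal.ofReal_lt_iff_lt_toReal ht0.le hxt).2 ht.2
        have hht : h x < 2 * ENNReal.ofReal t := by
          rw [← ENNReal.ofReal_toReal hxt, ← ENNReal.ofReal_ofNat 2,
            ← ENNReal.ofReal_mul (by norm_num)]
          exact (ENNReal.ofReal_lt_ofReal_iff (by linarith)).2 (by linarith [ht.1])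
        have hwt := hw_pos t htI
        simp only [hk, hht, if_true]
        gcongr
        rw [hΨ, hvx]
        refine (otermE_anti_right hφ _ (by positivity) (mul_le_mul_of_nonneg_left
            (hw_dec _ hmid t htI ht.1.le) hκ.le)).trans ?_
        exact otermE_mono_left hφ (le_decRe_of_lt_upDistr a f hth) (by positivity)
    _ ≤ _ := lintegral_mono_set hsub

lemma lintegral_decRe_le (hφ : IsOrliczFn φ)
    (hw_dec : ∀ s ∈ Ioa' a, ∀ t ∈ Ioa' a, s ≤ t → w t ≤ w s)
    (hw_pos : ∀ t ∈ Ioa' a, 0 < w t) (hC : 0 < C)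
    (hreg : ∀ t ∈ Ioa' a,
      ∫⁻ s in Set.Ioo 0 t, ENNReal.ofReal (w s) ≤ ENNReal.ofReal (C * t * w t))
    {L : ℝ} (hL : 4 * C * C ≤ L) {f : ℝ → ℝ} (hf : Measurable f)
    {v : ℝ → ℝ} (hv : Measurable v) (hv0 : ∀ t, 0 ≤ v t) (hvw : Submaj a v w) :
    ∫⁻ t in Ioa' a, otermE φ (decRe a f t / 2) (L * w t)
      ≤ 8 * ∫⁻ x in Ioa' a, otermE φ (ENNReal.ofReal |f x|) (v x) := by
  have hI := measurableSet_Ioa' a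
  set μ := volume.restrict (Ioa' a) with hμ
  set g : ℝ → ℝ≥0∞ := fun x => otermE φ (ENNReal.ofReal |f x|) (v x) with hg
  have hgm : AEMeasurable g μ := aemeasurable_otermE hφ hf.abs.ennreal_ofReal hv hI
    fun t _ => hv0 t
  by_cases hG : ∫⁻ x, g x ∂μ = ∞
  · rw [hG, ENNReal.mul_top (by norm_num)]
    exact le_top
  have hbad : ∀ τ ∈ Ioa' a, μ {x | C * w τ < v x} ≤ ENNReal.ofReal τ := by
    intro τ hτ
    refine (measure_mono fun x (hx : C * w τ < v x) => ?_).trans (measure_decRe_lt_le a v τ)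
    refine (decRe_le_of_submaj hw_dec hw_pos hreg hvw hτ).trans_lt ?_
    rw [abs_of_nonneg (hv0 x)]
    exact (ENNReal.ofReal_lt_ofReal_iff ((mul_pos hC (hw_pos τ hτ)).trans hx)).2 hx
  have hgle : ∀ s, ∀ τ ∈ Ioa' a, ∀ x, s < |f x| → v x ≤ C * w τ →
      otermE φ (ENNReal.ofReal s) (C * w τ) ≤ g x := fun s τ hτ x hsx hvx =>
    (otermE_anti_right hφ _ (hv0 x) hvx).trans
      (otermE_mono_left hφ (ENNReal.ofReal_le_ofReal hsx.le) (hv0 x))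
  have hmarkov : ∀ s, ∀ τ ∈ Ioa' a, otermE φ (ENNReal.ofReal s) (C * w τ) *
      μ {x | s < |f x| ∧ v x ≤ C * w τ} ≤ ∫⁻ x, g x ∂μ := fun s τ hτ =>
    (mul_le_mul_right (measure_mono fun x hx => hgle s τ hτ x hx.1 hx.2) _).trans
      (mul_meas_ge_le_lintegral₀ hgm _)
  have hsplit : ∀ s, ∀ τ ∈ Ioa' a,
      distr a f s ≤ μ {x | s < |f x| ∧ v x ≤ C * w τ} + ENNReal.ofReal τ := by
    intro s τ hτ
    rw [distr_eq]
    refine (measure_mono fun x (hx : s < |f x|) => ?_).trans ((measure_union_le _ _).trans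
      (add_le_add_right (hbad τ hτ) _))
    rcases le_or_gt (v x) (C * w τ) with h | h
    · exact Or.inl ⟨hx, h⟩
    · exact Or.inr h
  have hdistr : ∀ t ∈ Ioa' a, ∀ s, 0 < s → distr a f s ≠ ∞ := by
    intro t ht s hs htop
    have h1 : μ {x | s < |f x| ∧ v x ≤ C * w t} = ∞ := by
      have := hsplit s t ht
      rw [htop, top_le_iff, ENNReal.add_eq_top] at this
      exact this.resolve_right ENNReal.ofReal_ne_top
    have h2 := hmarkov s t ht
    rw [h1, ENNReal.mul_top
      (otermE_pos hφ (ENNReal.ofReal_pos.2 hs) (mul_pos hC (hw_pos t ht))).ne'] at h2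
    exact hG (top_le_iff.1 h2)
  have hdec : ∀ t ∈ Ioa' a, decRe a f t ≠ ∞ := by
    intro t ht htop
    have ht0 : 0 < t := ht.1
    have hτ : t / 2 ∈ Ioa' a := Ioa'_mem_of_le ht (by linarith) (by linarith)
    set δ := otermE φ 1 (C * w (t / 2)) with hδ
    have hCw : 0 < C * w (t / 2) := mul_pos hC (hw_pos _ hτ)
    have hδ0 : 0 < δ := otermE_pos hφ one_pos hCw
    have hlow : ∀ s, 0 ≤ s →
        ENNReal.ofReal (t / 2) ≤ μ {x | s < |f x| ∧ v x ≤ C * w (t / 2)} := by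
      intro s hs
      have h1 := lt_distr_of_lt_decRe a f hs (t := t) (htop ▸ ENNReal.ofReal_lt_top)
      have h2 := h1.le.trans (hsplit s _ hτ)
      rw [show ENNReal.ofReal t = ENNReal.ofReal (t / 2) + ENNReal.ofReal (t / 2) by
        rw [← ENNReal.ofReal_add (by linarith) (by linarith), add_halves]] at h2
      exact (ENNReal.add_le_add_iff_right ENNReal.ofReal_ne_top).1 h2
    have hpos : δ * ENNReal.ofReal (t / 2) ≠ 0 :=
      mul_ne_zero hδ0.ne' (by simpa using ht0)
    obtain ⟨n, hn⟩ := ENNReal.exists_nat_mul_gt hpos hG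
    have hn1 : 1 ≤ n := Nat.one_le_iff_ne_zero.2 fun h => by simp [h] at hn
    refine absurd hn (not_lt.2 ?_)
    calc (n : ℝ≥0∞) * (δ * ENNReal.ofReal (t / 2))
        = (n * δ) * ENNReal.ofReal (t / 2) := (mul_assoc _ _ _).symm
      _ ≤ otermE φ (ENNReal.ofReal n) (C * w (t / 2)) *
          μ {x | (n : ℝ) < |f x| ∧ v x ≤ C * w (t / 2)} := by
          gcongr
          · rw [ENNReal.ofReal_natCast]
            exact natCast_mul_otermE_one_le hφ hn1 hCw
          · exact hlow n n.cast_nonneg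
      _ ≤ _ := hmarkov n _ hτ
  set k : ℝ → ℝ → ℝ≥0∞ := fun t x =>
    if ENNReal.ofReal t < 2 * upDistr a f |f x| then 4 / upDistr a f |f x| else 0 with hk
  have hum := measurable_upDistr a hf
  have hkm : Measurable (Function.uncurry k) := by
    refine Measurable.ite (measurableSet_lt (ENNReal.measurable_ofReal.comp measurable_fst)
      ((hum.comp measurable_snd).const_mul 2)) ?_ measurable_const
    exact measurable_const.div (hum.comp measurable_snd)
  refine le_trans (setLIntegral_mono' hI fun t ht => ?_) (lintegral_lintegral_mul_le (μ := μ)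
    hgm hkm fun x => lintegral_ite_ofReal_lt_le a (upDistr a f |f x|))
  have ht0 : 0 < t := ht.1
  have hwt := hw_pos t ht
  by_cases hz : decRe a f t = 0
  · simp [hz, otermE_zero_left hφ]
  set c := (decRe a f t).toReal with hc
  have hc0 : 0 < c := ENNReal.toReal_pos hz (hdec t ht)
  have hcd : decRe a f t = ENNReal.ofReal c := (ENNReal.ofReal_toReal (hdec t ht)).symm
  have hτ : t / 4 ∈ Ioa' a := Ioa'_mem_of_le ht (by linarith) (by linarith)
  have hCw : 0 < C * w (t / 4) := mul_pos hC (hw_pos _ hτ)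
  set D := distr a f (c / 2) with hD
  have hDfin : D ≠ ∞ := hdistr t ht _ (by positivity)
  have hDt : ENNReal.ofReal t < D := lt_distr_of_lt_decRe a f (by positivity) (by
    rw [hcd]
    exact (ENNReal.ofReal_lt_ofReal_iff hc0).2 (by linarith))
  have hD0 : D ≠ 0 := (zero_le.trans_lt hDt).ne'
  set U : Set ℝ := {x | c / 2 < |f x| ∧ ENNReal.ofReal (t / 2) < upDistr a f |f x| ∧
    v x ≤ C * w (t / 4)} with hU
  have hUm : MeasurableSet U := (measurableSet_lt measurable_const hf.abs).inter
    ((measurableSet_lt measurable_const hum).inter (measurableSet_le hv measurable_const))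
  have hDU : D ≤ 4 * μ U := by
    have h1 : D ≤ μ U + (ENNReal.ofReal (t / 2) + ENNReal.ofReal (t / 4)) := by
      rw [hD, distr_eq]
      refine (measure_mono (t := U ∪ ({x | upDistr a f |f x| ≤ ENNReal.ofReal (t / 2)} ∪
        {x | C * w (t / 4) < v x})) fun x (hx : c / 2 < |f x|) => ?_).trans
        ((measure_union_le _ _).trans (add_le_add_right ((measure_union_le _ _).trans
          (add_le_add (measure_upDistr_le_le a f _) (hbad _ hτ))) _))
      rcases le_or_gt (upDistr a f |f x|) (ENNReal.ofReal (t / 2)) with h | h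
      · exact Or.inr (Or.inl h)
      rcases le_or_gt (v x) (C * w (t / 4)) with h' | h'
      · exact Or.inl ⟨hx, h, h'⟩
      · exact Or.inr (Or.inr h')
    have hUfin : μ U ≠ ∞ := ne_top_of_le_ne_top hDfin (by
      rw [hD, distr_eq]
      exact measure_mono fun x hx => hx.1)
    rw [← ENNReal.ofReal_toReal hDfin, ← ENNReal.ofReal_toReal hUfin,
      ← ENNReal.ofReal_add (by linarith) (by linarith),
      ← ENNReal.ofReal_add ENNReal.toReal_nonneg (by linarith),
      ENNReal.ofReal_le_ofReal_iff (add_nonneg ENNReal.toReal_nonneg (by linarith))] at h1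
    have h2 := (ENNReal.ofReal_lt_iff_lt_toReal ht0.le hDfin).1 hDt
    rw [← ENNReal.ofReal_toReal hDfin, ← ENNReal.ofReal_toReal hUfin,
      ← ENNReal.ofReal_ofNat 4, ← ENNReal.ofReal_mul (by norm_num)]
    exact ENNReal.ofReal_le_ofReal (by linarith)
  have hCL : C * w (t / 4) ≤ L * w t := by
    have := regular_weight_le hw_dec hw_pos hC hreg hτ ht (by linarith) (by linarith)
    calc C * w (t / 4) ≤ C * (4 * C * w t) := by gcongr
      _ = 4 * C * C * w t := by ring
      _ ≤ L * w t := by gcongr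
  have hc2 : decRe a f t / 2 = ENNReal.ofReal (c / 2) := by
    rw [hcd, ENNReal.ofReal_div_of_pos two_pos, ENNReal.ofReal_ofNat]
  set Ψ := otermE φ (ENNReal.ofReal (c / 2)) (C * w (t / 4)) with hΨ
  calc otermE φ (decRe a f t / 2) (L * w t) ≤ Ψ := by
        rw [hc2]
        exact otermE_anti_right hφ _ hCw.le hCL
    _ = Ψ * 1 := (mul_one _).symm
    _ ≤ Ψ * (4 / D * μ U) := by
        gcongr
        rw [ENNReal.div_eq_inv_mul, mul_assoc, ← ENNReal.inv_mul_cancel hD0 hDfin]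
        gcongr
    _ = ∫⁻ x in U, Ψ * (4 / D) ∂μ := by rw [setLIntegral_const, mul_assoc]
    _ ≤ ∫⁻ x in U, g x * k t x ∂μ := by
        refine setLIntegral_mono' hUm fun x hx => ?_
        have hlt : ENNReal.ofReal t < 2 * upDistr a f |f x| := by
          calc ENNReal.ofReal t = 2 * ENNReal.ofReal (t / 2) := by
                rw [← ENNReal.ofReal_ofNat 2, ← ENNReal.ofReal_mul (by norm_num)]
                congr 1
                ring
            _ < _ := (ENNReal.mul_lt_mul_iff_right two_ne_zero ENNReal.ofNat_ne_top).2 hx.2.1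
        simp only [hk, hlt, if_true]
        gcongr
        · exact hgle _ _ hτ x hx.1 hx.2.2
        · exact upDistr_le_distr a f hx.1
    _ ≤ _ := setLIntegral_le_lintegral _ _

end Weight

lemma iInf_ofReal_le_mul_iInf_ofReal {S T : Set ℝ} {K : ℝ} (hK : 0 < K)
    (h : ∀ ε ∈ T, K * ε ∈ S) :
    ⨅ ε ∈ S, ENNReal.ofReal ε ≤ ENNReal.ofReal K * ⨅ ε ∈ T, ENNReal.ofReal ε := by
  have hK0 : ENNReal.ofReal K ≠ 0 := by simpa using hK
  rw [ENNReal.mul_iInf_of_ne hK0 ENNReal.ofReal_ne_top]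
  refine le_iInf fun ε => ?_
  rw [ENNReal.mul_iInf_of_ne hK0 ENNReal.ofReal_ne_top]
  refine le_iInf fun hε => ?_
  rw [← ENNReal.ofReal_mul hK.le]
  exact iInf₂_le (K * ε) (h ε hε)

lemma PmodE_div (a : ℝ≥0∞) (φ w f : ℝ → ℝ) {ε : ℝ} (hε : 0 < ε) :
    PmodE a φ w (fun t => ENNReal.ofReal |f t| / ENNReal.ofReal ε)
      = Pmod a φ w fun t => f t / ε := by
  unfold Pmod
  congr 1
  ext t
  rw [abs_div, abs_of_pos hε, ENNReal.ofReal_div_of_pos hε]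

/-- For a regular weight the modulars `P` and `M` dominate each other up to a dilation of the
argument. -/
lemma exists_Pmod_div_le_and_Mmod_div_le {a : ℝ≥0∞} {φ : ℝ → ℝ} (hφ : IsOrliczFn φ)
    {w : ℝ → ℝ} (hw_meas : Measurable w) (hw_pos : ∀ t ∈ Ioa' a, 0 < w t)
    (hw_dec : ∀ s ∈ Ioa' a, ∀ t ∈ Ioa' a, s ≤ t → w t ≤ w s)
    (hreg : ∃ C > 0, ∀ t ∈ Ioa' a,
      ∫⁻ s in Set.Ioo 0 t, ENNReal.ofReal (w s) ≤ ENNReal.ofReal (C * t * w t)) :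
    ∃ K : ℝ, 0 < K ∧ ∀ f : ℝ → ℝ, Measurable f →
      Pmod a φ w (fun t => f t / K) ≤ Mmod a φ w f ∧
      Mmod a φ w (fun t => f t / K) ≤ Pmod a φ w f := by
  obtain ⟨C, hC, hreg⟩ := hreg
  have hI := measurableSet_Ioa' a
  set K : ℝ := max (max (8 * C * C) (4 * C)) 16 with hK
  have hK1 : 8 * C * C ≤ K := (le_max_left _ _).trans (le_max_left _ _)
  have hK2 : 4 * C ≤ K := (le_max_right _ _).trans (le_max_left _ _)
  have hK3 : 16 ≤ K := le_max_right _ _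
  have hK0 : 0 < K := by linarith
  refine ⟨K, hK0, fun f hf => ⟨?_, ?_⟩⟩
  · have hκ : 0 < K⁻¹ := by positivity
    refine (Pmod_le_lintegral hφ hw_meas hw_dec hw_pos hκ ?_ (hf.div_const K)).trans ?_
    · intro s hs t ht hst hts
      have h1 := regular_weight_le hw_dec hw_pos hC hreg hs ht hst hts
      have hwt := hw_pos t ht
      rw [inv_mul_le_iff₀ hK0]
      exact h1.trans (by gcongr)
    · have hle : ∀ t, decRe a (fun x => f x / K) t / ENNReal.ofReal K⁻¹ ≤ decRe a f t := by
        intro t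
        rw [ENNReal.ofReal_inv_of_pos hK0, ENNReal.div_eq_inv_mul, inv_inv]
        calc ENNReal.ofReal K * decRe a (fun x => f x / K) t
            ≤ ENNReal.ofReal K * (decRe a f t / ENNReal.ofReal K) := by
              gcongr
              exact decRe_div_le a f hK0 t
          _ ≤ decRe a f t := ENNReal.mul_div_le
      calc 4 * ∫⁻ t in Ioa' a, otermE φ (decRe a (fun x => f x / K) t) (K⁻¹ * w t)
          ≤ 4 * ∫⁻ t in Ioa' a, ENNReal.ofReal K⁻¹ * otermE φ (decRe a f t) (w t) := by
            gcongr 4 * ?_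
            refine setLIntegral_mono' hI fun t ht => ?_
            rw [otermE_mul_right φ _ hκ]
            gcongr
            exact otermE_mono_left hφ (hle t) (hw_pos t ht).le
        _ = ENNReal.ofReal (4 * K⁻¹) * Mmod a φ w f := by
            rw [lintegral_const_mul' _ _ ENNReal.ofReal_ne_top, ← mul_assoc,
              ENNReal.ofReal_mul (by norm_num), ENNReal.ofReal_ofNat, Mmod]
        _ ≤ 1 * Mmod a φ w f := by
            gcongr
            rw [ENNReal.ofReal_le_one, ← div_eq_mul_inv, div_le_one hK0]
            linarith
        _ = Mmod a φ w f := one_mul _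
  · refine le_iInf₂ fun v hv => ?_
    have hL0 : 0 < K / 2 := by positivity
    have h1 := lintegral_decRe_le hφ hw_dec hw_pos hC hreg (L := K / 2) (by linarith) hf
      hv.1 hv.2.1 hv.2.2
    have h2 : ENNReal.ofReal (K / 2) * Mmod a φ w (fun t => f t / K)
        ≤ ∫⁻ t in Ioa' a, otermE φ (decRe a f t / 2) (K / 2 * w t) := by
      rw [Mmod, ← lintegral_const_mul' _ _ ENNReal.ofReal_ne_top]
      refine setLIntegral_mono' hI fun t ht => ?_
      rw [otermE_mul_right φ _ hL0]
      gcongr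
      refine otermE_mono_left hφ ((decRe_div_le a f hK0 t).trans_eq ?_) (hw_pos t ht).le
      rw [div_eq_mul_inv, div_eq_mul_inv, div_eq_mul_inv, mul_assoc,
        ← ENNReal.mul_inv (Or.inl two_ne_zero) (Or.inl ENNReal.ofNat_ne_top),
        ← ENNReal.ofReal_ofNat 2, ← ENNReal.ofReal_mul (by norm_num)]
      congr 3
      ring
    have h3 := h2.trans h1
    have h4 : (8 : ℝ≥0∞) ≤ ENNReal.ofReal (K / 2) := by
      rw [← ENNReal.ofReal_ofNat 8]
      exact ENNReal.ofReal_le_ofReal (by linarith)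
    refine (ENNReal.mul_le_mul_iff_right (a := 8) (by norm_num) ENNReal.ofNat_ne_top).1
      (le_trans ?_ h3)
    gcongr

/-- if the weight `w` is regular (`W(t) ≤ C·t·w(t)`), then the classes
`𝓜_{φ,w}` and `M_{φ,w}` coincide and the functionals `‖·‖_𝓜` and `‖·‖_M` are
equivalent. -/
theorem statement15 (a : ℝ≥0∞) (ha : 0 < a) (φ : ℝ → ℝ) (hφ : IsOrliczFn φ)
    (w : ℝ → ℝ) (hw_meas : Measurable w) (hw_pos : ∀ t ∈ Ioa' a, 0 < w t)
    (hw_dec : ∀ s ∈ Ioa' a, ∀ t ∈ Ioa' a, s ≤ t → w t ≤ w s)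
    (hreg : ∃ C > 0, ∀ t ∈ Ioa' a,
      ∫⁻ s in Set.Ioo 0 t, ENNReal.ofReal (w s) ≤ ENNReal.ofReal (C * t * w t)) :
    Pclass a φ w = Mclass a φ w ∧
      ∃ C > 0, ∀ f : ℝ → ℝ, Measurable f →
        Pnorm a φ w f ≤ ENNReal.ofReal C * Mnorm a φ w f ∧
        Mnorm a φ w f ≤ ENNReal.ofReal C * Pnorm a φ w f := by
  obtain ⟨K, hK, h⟩ := exists_Pmod_div_le_and_Mmod_div_le hφ hw_meas hw_pos hw_dec hreg
  refine ⟨?_, K, hK, fun f hf => ⟨?_, ?_⟩⟩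
  · ext f
    refine ⟨fun ⟨hf, c, hc, hfin⟩ => ⟨hf, c / K, by positivity, ?_⟩,
      fun ⟨hf, c, hc, hfin⟩ => ⟨hf, c / K, by positivity, ?_⟩⟩
    · simp only [div_mul_eq_mul_div]
      exact ((h _ (hf.const_mul c)).2).trans_lt hfin
    · simp only [div_mul_eq_mul_div]
      exact ((h _ (hf.const_mul c)).1).trans_lt hfin
  · refine iInf_ofReal_le_mul_iInf_ofReal hK fun ε hε => ⟨mul_pos hK hε.1, ?_⟩
    rw [PmodE_div a φ w f (mul_pos hK hε.1)]
    simp only [mul_comm K ε, ← div_div]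
    exact ((h _ (hf.div_const ε)).1).trans hε.2
  · refine iInf_ofReal_le_mul_iInf_ofReal hK fun ε hε => ⟨mul_pos hK hε.1, ?_⟩
    have hP := hε.2
    rw [PmodE_div a φ w f hε.1] at hP
    simp only [mul_comm K ε, ← div_div]
    exact ((h _ (hf.div_const ε)).2).trans hP

end OrliczRearrangement

end
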